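/- Under the uniform local ℓ_p stability assumption and the stated conditions on α and γ, suppose w is a bounded real-valued function on the nonempty compact subsets of ℝ^n that satisfies w(X) − w(F(X)) = ξ(X)·(1 − w(F(X))) for all nonempty compact X ⊆ ℝ^n (where ξ(X) := 1 − exp(−Ψ(X))), and that satisfies: for every nonempty compact X, if d_H^a(R(X,k),𝒜) → 0 as k → ∞ then w(R(X,k)) → 0. Then w(X) = W(X) for every nonempty compact X ⊆ ℝ^n (uniqueness of the bounded solution of the Zubov-type equation). -/

import Mathlib

open Metric Set Filter Topology TopologicalSpace ENNReal

noncomputable section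

abbrev Euc (n : ℕ) : Type := EuclideanSpace ℝ (Fin n)

/-- Trajectory of the discrete-time uncertain system `x_{k+1} = f (x_k) (w_k)`. -/
def traj {n m : ℕ} (f : Euc n → Euc m → Euc n) (x : Euc n) (π : ℕ → Euc m) : ℕ → Euc n
  | 0 => x
  | k + 1 => f (traj f x π k) (π k)

/-- Reachable set of `X` at time `k` under disturbance signals taking values in `W`. -/
def reach {n m : ℕ} (f : Euc n → Euc m → Euc n) (W : Set (Euc m)) (X : Set (Euc n)) (k : ℕ) :
    Set (Euc n) :=
  {y | ∃ x ∈ X, ∃ π : ℕ → Euc m, (∀ j, π j ∈ W) ∧ y = traj f x π k}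

/-- The one-step set-valued map `F(X) = {f x w : x ∈ X, w ∈ W}`. -/
def Fmap {n m : ℕ} (f : Euc n → Euc m → Euc n) (W : Set (Euc m)) (X : Set (Euc n)) :
    Set (Euc n) :=
  Set.image2 f X W

/-- Asymmetric (directed) Hausdorff distance `sup_{x ∈ A} dist(x, B)`. -/
def dHa {n : ℕ} (A B : Set (Euc n)) : ℝ := ⨆ x : A, Metric.infDist (x : Euc n) B

/-- Uniform local ℓ_p stability of the robust invariant set `𝒜` within the safe set `𝒳`. -/
structure LpStable {n m : ℕ} (f : Euc n → Euc m → Euc n) (W : Set (Euc m))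
    (𝒳 𝒜 : Set (Euc n)) where
  r : ℝ
  M : ℝ
  p : ℝ
  lam : ℝ → ℕ → ℝ
  r_pos : 0 < r
  M_ge_one : 1 ≤ M
  p_pos : 0 < p
  lam_nonneg : ∀ s ∈ Set.Icc (0 : ℝ) r, ∀ k : ℕ, 0 ≤ lam s k
  lam_cont : ∀ k : ℕ, ContinuousOn (fun s => lam s k) (Set.Icc (0 : ℝ) r)
  lam_mono : ∀ k : ℕ, MonotoneOn (fun s => lam s k) (Set.Icc (0 : ℝ) r)
  lam_zero : ∀ k : ℕ, lam 0 k = 0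
  lam_anti : ∀ s ∈ Set.Icc (0 : ℝ) r, ∀ k l : ℕ, k ≤ l → lam s l ≤ lam s k
  lam_le_id : ∀ s ∈ Set.Icc (0 : ℝ) r, lam s 0 ≤ s
  lam_summable : Summable fun k : ℕ => lam r k ^ p
  stab : ∀ x ∈ 𝒳, Metric.infDist x 𝒜 ≤ r →
    ∀ π : ℕ → Euc m, (∀ j, π j ∈ W) →
      ∀ k : ℕ, Metric.infDist (traj f x π k) 𝒜 ≤ M * lam (Metric.infDist x 𝒜) k

/-- The safe robust domain of uniform attraction. -/
def DOUA {n m : ℕ} (f : Euc n → Euc m → Euc n) (W : Set (Euc m)) (𝒳 𝒜 : Set (Euc n)) :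
    Set (Euc n) :=
  {x | (∀ k : ℕ, reach f W {x} k ⊆ 𝒳) ∧
    Filter.Tendsto (fun k => dHa (reach f W {x} k) 𝒜) Filter.atTop (nhds 0)}

/-- The safe robust domain of attraction. -/
def DOA {n m : ℕ} (f : Euc n → Euc m → Euc n) (W : Set (Euc m)) (𝒳 𝒜 : Set (Euc n)) :
    Set (Euc n) :=
  {x | ∀ π : ℕ → Euc m, (∀ j, π j ∈ W) →
    (∀ k : ℕ, traj f x π k ∈ 𝒳) ∧
      Filter.Tendsto (fun k => Metric.infDist (traj f x π k) 𝒜) Filter.atTop (nhds 0)}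

/-- `Ψ(X) = (sup_{y∈X} γ y) * (sup_{y∈X} α y)`. -/
def Psi {n : ℕ} (α : Euc n → ℝ) (γ : Euc n → ℝ≥0∞) (X : Set (Euc n)) : ℝ≥0∞ :=
  (⨆ y : X, γ (y : Euc n)) * ENNReal.ofReal (⨆ y : X, α (y : Euc n))

/-- The value function `V(X) = Σ_k Ψ(R(X,k))`. -/
def Vval {n m : ℕ} (f : Euc n → Euc m → Euc n) (W : Set (Euc m)) (α : Euc n → ℝ)
    (γ : Euc n → ℝ≥0∞) (X : Set (Euc n)) : ℝ≥0∞ :=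
  ∑' k : ℕ, Psi α γ (reach f W X k)

/-- `exp(-a)` for `a ∈ [0,∞]`, with `exp(-∞) = 0`. -/
def expNeg (a : ℝ≥0∞) : ℝ := if a = ⊤ then 0 else Real.exp (-a.toReal)

/-- The value function `W(X) = 1 - exp(-V(X))`. -/
def Wval {n m : ℕ} (f : Euc n → Euc m → Euc n) (W : Set (Euc m)) (α : Euc n → ℝ)
    (γ : Euc n → ℝ≥0∞) (X : Set (Euc n)) : ℝ :=
  1 - expNeg (Vval f W α γ X)

/-- `ξ(X) = 1 - exp(-Ψ(X))`. -/
def xival {n : ℕ} (α : Euc n → ℝ) (γ : Euc n → ℝ≥0∞) (X : Set (Euc n)) : ℝ :=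
  1 - expNeg (Psi α γ X)

/-- `β(X) = exp(Ψ(X)) - 1`. -/
def betaval {n : ℕ} (α : Euc n → ℝ) (γ : Euc n → ℝ≥0∞) (X : Set (Euc n)) : ℝ :=
  Real.exp ((Psi α γ X).toReal) - 1

/-- Conditions on `α`: continuous with `α̲ dist(x,𝒜)^p̄ ≤ α(x) ≤ ᾱ dist(x,𝒜)^p̄`. -/
def AlphaHyp {n : ℕ} (𝒜 : Set (Euc n)) (α : Euc n → ℝ) (αlow αup pbar : ℝ) : Prop :=
  Continuous α ∧ 0 < αlow ∧ αlow ≤ αup ∧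
    ∀ x : Euc n, αlow * Metric.infDist x 𝒜 ^ pbar ≤ α x ∧
      α x ≤ αup * Metric.infDist x 𝒜 ^ pbar

/-- Conditions on `γ`: finite, continuous and `≥ γ̲ > 0` on `𝒳`, `= ∞` outside `𝒳`,
blowing up along sequences converging to the boundary of `𝒳`. -/
def GammaHyp {n : ℕ} (𝒳 : Set (Euc n)) (γ : Euc n → ℝ≥0∞) (γlow : ℝ) : Prop :=
  (∀ x ∈ 𝒳, γ x ≠ ⊤) ∧ ContinuousOn γ 𝒳 ∧ 0 < γlow ∧
    (∀ x ∈ 𝒳, ENNReal.ofReal γlow ≤ γ x) ∧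
    (∀ x ∉ 𝒳, γ x = ⊤) ∧
    ∀ (u : ℕ → Euc n) (x : Euc n), x ∈ frontier 𝒳 →
      Filter.Tendsto u Filter.atTop (nhds x) →
      Filter.Tendsto (fun k => γ (u k)) Filter.atTop (nhds ⊤)

theorem aux_traj_congr {n m : ℕ} (f : Euc n → Euc m → Euc n) (x : Euc n) (π π' : ℕ → Euc m)
    (k : ℕ) (h : ∀ j < k, π j = π' j) : traj f x π k = traj f x π' k := by
  induction k with
  | zero => rfl
  | succ k ih =>
    simp only [traj]
    rw [ih (fun j hj => h j (by omega)), h k (by omega)]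

theorem aux_reach_zero {n m : ℕ} (f : Euc n → Euc m → Euc n) (W : Set (Euc m))
    (hW : W.Nonempty) (X : Set (Euc n)) : reach f W X 0 = X := by
  obtain ⟨w, hw⟩ := hW
  ext y
  constructor
  · rintro ⟨x, hx, π, _, rfl⟩
    exact hx
  · intro hy
    exact ⟨y, hy, fun _ => w, fun _ => hw, rfl⟩

theorem aux_reach_succ {n m : ℕ} (f : Euc n → Euc m → Euc n) (W : Set (Euc m))
    (X : Set (Euc n)) (k : ℕ) : reach f W X (k + 1) = Fmap f W (reach f W X k) := by
  ext y
  constructor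
  · rintro ⟨x, hx, π, hπ, rfl⟩
    exact ⟨traj f x π k, ⟨x, hx, π, hπ, rfl⟩, π k, hπ k, rfl⟩
  · rintro ⟨z, ⟨x, hx, π, hπ, rfl⟩, w, hw, rfl⟩
    refine ⟨x, hx, Function.update π k w, ?_, ?_⟩
    · intro j
      by_cases hj : j = k
      · subst hj; simpa using hw
      · simpa [Function.update_of_ne hj] using hπ j
    · simp only [traj, Function.update_self]
      rw [aux_traj_congr f x π (Function.update π k w) k]
      intro j hj
      rw [Function.update_of_ne (by omega)]

theorem aux_reach_good {n m : ℕ} (f : Euc n → Euc m → Euc n)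
    (hf : Continuous fun p : Euc n × Euc m => f p.1 p.2) (W : Set (Euc m))
    (hW : W.Nonempty) (hWc : IsCompact W) (X : Set (Euc n)) (hX : X.Nonempty)
    (hXc : IsCompact X) (k : ℕ) :
    (reach f W X k).Nonempty ∧ IsCompact (reach f W X k) := by
  induction k with
  | zero => rw [aux_reach_zero f W hW]; exact ⟨hX, hXc⟩
  | succ k ih =>
    rw [aux_reach_succ, Fmap]
    refine ⟨ih.1.image2 hW, ?_⟩
    rw [← Set.image_prod]
    exact (ih.2.prod hWc).image hf

theorem aux_expNeg_add (a b : ℝ≥0∞) : expNeg (a + b) = expNeg a * expNeg b := by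
  unfold expNeg
  by_cases ha : a = ⊤
  · simp [ha]
  by_cases hb : b = ⊤
  · simp [hb]
  rw [if_neg ha, if_neg hb, if_neg (ENNReal.add_ne_top.2 ⟨ha, hb⟩), ENNReal.toReal_add ha hb,
    neg_add, Real.exp_add]

theorem aux_expNeg_tendsto (S : ℕ → ℝ≥0∞) (V : ℝ≥0∞) (h : Tendsto S atTop (𝓝 V)) :
    Tendsto (fun k => expNeg (S k)) atTop (𝓝 (expNeg V)) := by
  by_cases hV : V = ⊤
  · subst hV
    have h0 : expNeg ⊤ = 0 := by simp [expNeg]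
    rw [h0, Metric.tendsto_atTop']
    intro ε hε
    obtain ⟨B, hB0, hB⟩ := ((eventually_ge_atTop (0:ℝ)).and
      (Real.tendsto_exp_neg_atTop_nhds_zero.eventually (gt_mem_nhds hε))).exists
    have h1 := h.eventually (lt_mem_nhds (ENNReal.ofReal_lt_top (r := B)))
    obtain ⟨N, hN⟩ := eventually_atTop.1 h1
    refine ⟨N, fun k hk => ?_⟩
    have h2 := hN k hk.le
    unfold expNeg
    split_ifs with ht
    · simpa using hε
    · rw [Real.dist_eq, sub_zero, abs_of_pos (Real.exp_pos _)]
      refine lt_of_le_of_lt ?_ hB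
      have := (ENNReal.ofReal_lt_iff_lt_toReal hB0 ht).1 h2
      exact Real.exp_le_exp.2 (by linarith)
  · have h1 : ∀ᶠ k in atTop, S k < ⊤ := h.eventually (gt_mem_nhds (lt_top_iff_ne_top.2 hV))
    have h2 : Tendsto (fun k => Real.exp (-(S k).toReal)) atTop (𝓝 (expNeg V)) := by
      rw [expNeg, if_neg hV]
      exact (Real.continuous_exp.tendsto _).comp (((ENNReal.tendsto_toReal hV).comp h).neg)
    refine h2.congr' ?_
    filter_upwards [h1] with k hk
    rw [expNeg, if_neg hk.ne]

theorem stmt18 {n m : ℕ}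
    (f : Euc n → Euc m → Euc n) (hf : Continuous fun p : Euc n × Euc m => f p.1 p.2)
    (Wd : Set (Euc m)) (hWne : Wd.Nonempty) (hWc : IsCompact Wd)
    (𝒳 : Set (Euc n)) (h𝒳 : IsOpen 𝒳)
    (𝒜 : Set (Euc n)) (h𝒜ne : 𝒜.Nonempty) (h𝒜c : IsCompact 𝒜) (h𝒜𝒳 : 𝒜 ⊆ 𝒳)
    (h𝒜inv : ∀ x ∈ 𝒜, ∀ w ∈ Wd, f x w ∈ 𝒜)
    (H : LpStable f Wd 𝒳 𝒜)
    (α : Euc n → ℝ) (αlow αup pbar : ℝ) (hα : AlphaHyp 𝒜 α αlow αup pbar)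
    (hpbar : H.p ≤ pbar)
    (γ : Euc n → ℝ≥0∞) (γlow : ℝ) (hγ : GammaHyp 𝒳 γ γlow)
    (w : Set (Euc n) → ℝ) (C : ℝ)
    (hbdd : ∀ X : Set (Euc n), X.Nonempty → IsCompact X → |w X| ≤ C)
    (hw : ∀ X : Set (Euc n), X.Nonempty → IsCompact X →
      w X - w (Fmap f Wd X) = xival α γ X * (1 - w (Fmap f Wd X)))
    (hlim : ∀ X : Set (Euc n), X.Nonempty → IsCompact X →
      Filter.Tendsto (fun k => dHa (reach f Wd X k) 𝒜) Filter.atTop (nhds 0) →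
      Filter.Tendsto (fun k => w (reach f Wd X k)) Filter.atTop (nhds 0)) :
    ∀ X : Set (Euc n), X.Nonempty → IsCompact X → w X = Wval f Wd α γ X := by
  obtain ⟨hαc, hαl, -, hαb⟩ := hα
  obtain ⟨-, -, hγl, hγ1, hγ2, -⟩ := hγ
  have hp0 : 0 < pbar := H.p_pos.trans_le hpbar
  intro X hX hXc
  have hg := aux_reach_good f hf Wd hWne hWc X hX hXc
  have hiter : ∀ k, 1 - w X = expNeg (∑ i ∈ Finset.range k, Psi α γ (reach f Wd X i)) *
      (1 - w (reach f Wd X k)) := by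
    intro k
    induction k with
    | zero => simp [aux_reach_zero f Wd hWne, expNeg]
    | succ k ih =>
      have h1 := hw _ (hg k).1 (hg k).2
      rw [← aux_reach_succ, xival] at h1
      rw [ih, Finset.sum_range_succ, aux_expNeg_add, mul_assoc]
      congr 1
      linarith
  have hlimE := aux_expNeg_tendsto _ _
    (ENNReal.tendsto_nat_tsum (fun k => Psi α γ (reach f Wd X k)))
  change Tendsto _ _ (𝓝 (expNeg (Vval f Wd α γ X))) at hlimE
  suffices h : 1 - w X = expNeg (Vval f Wd α γ X) by
    rw [Wval]; linarith
  by_cases hV : Vval f Wd α γ X = ⊤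
  · rw [hV] at hlimE ⊢
    have h0 : expNeg ⊤ = 0 := by simp [expNeg]
    rw [h0] at hlimE ⊢
    have h2 : Tendsto (fun k => expNeg (∑ i ∈ Finset.range k, Psi α γ (reach f Wd X i)) *
      (1 - w (reach f Wd X k))) atTop (𝓝 0) := by
      refine hlimE.zero_mul_isBoundedUnder_le ?_
      refine isBoundedUnder_of ⟨1 + C, fun k => ?_⟩
      have := abs_le.1 (hbdd _ (hg k).1 (hg k).2)
      simp only [Function.comp, Real.norm_eq_abs]
      rw [abs_le]
      constructor <;> linarith
    exact tendsto_nhds_unique (tendsto_const_nhds.congr hiter) h2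
  · have hP : Tendsto (fun k => Psi α γ (reach f Wd X k)) atTop (𝓝 0) :=
      ENNReal.tendsto_atTop_zero_of_tsum_ne_top hV
    have hd : Tendsto (fun k => dHa (reach f Wd X k) 𝒜) atTop (𝓝 0) := by
      rw [Metric.tendsto_atTop']
      intro ε hε
      have hδ : 0 < αlow * (ε / 2) ^ pbar := by positivity
      have hpos : 0 < ENNReal.ofReal γlow * ENNReal.ofReal (αlow * (ε / 2) ^ pbar) :=
        ENNReal.mul_pos (by simpa using hγl) (by simpa using hδ)
      obtain ⟨N, hN⟩ := eventually_atTop.1 (hP.eventually (gt_mem_nhds hpos))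
      refine ⟨N, fun k hk => ?_⟩
      have hk := hN k hk.le
      obtain ⟨⟨y0, hy0⟩, hc⟩ := hg k
      have hnn : 0 ≤ dHa (reach f Wd X k) 𝒜 := Real.iSup_nonneg fun _ => infDist_nonneg
      rw [Real.dist_eq, sub_zero, abs_of_nonneg hnn]
      refine lt_of_le_of_lt ?_ (half_lt_self hε)
      haveI : Nonempty (reach f Wd X k) := ⟨⟨y0, hy0⟩⟩
      refine ciSup_le fun y => ?_
      by_contra! hlt
      refine absurd hk (not_lt.2 ?_)
      unfold Psi
      refine mul_le_mul' ?_ (ENNReal.ofReal_le_ofReal ?_)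
      · refine le_trans ?_ (le_iSup (fun y : reach f Wd X k => γ y) y)
        by_cases hyX : (y : Euc n) ∈ 𝒳
        · exact hγ1 _ hyX
        · rw [hγ2 _ hyX]; exact le_top
      · have hb : BddAbove (range fun y : reach f Wd X k => α y) := by
          have := hc.bddAbove_image hαc.continuousOn
          rwa [image_eq_range] at this
        refine le_trans ?_ (le_ciSup hb y)
        refine le_trans ?_ (hαb y).1
        gcongr
    have hw0 := hlim X hX hXc hd
    have h3 := hlimE.mul (hw0.const_sub 1)
    rw [sub_zero, mul_one] at h3
    exact tendsto_nhds_unique (tendsto_const_nhds.congr hiter) h3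
end
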